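/- arXiv:2008.13036 — 3 statements merged into one kernel-verified Lean document; each statement's English description precedes it below -/
import Mathlib

section
/- Let v ∈ ℝᵐ be a unit Fiedler vector of layer 2, i.e. ‖v‖ = 1, vᵀ1ₘ = 0 and L₂v = λ₂⁽²⁾·v where λ₂⁽²⁾ = λ₂(L₂). Then for every n×m matrix W with nonnegative entries, λ₂(L(W)) ≤ λ₂⁽²⁾ + vᵀ·diag(Wᵀ1ₙ)·v. -/
open Matrix

noncomputable def supraLap {n m : ℕ} (L₁ : Matrix (Fin n) (Fin n) ℝ)
    (L₂ : Matrix (Fin m) (Fin m) ℝ) (W : Matrix (Fin n) (Fin m) ℝ) :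
    Matrix (Fin n ⊕ Fin m) (Fin n ⊕ Fin m) ℝ :=
  Matrix.fromBlocks (L₁ + Matrix.diagonal (W *ᵥ fun _ => 1)) (-W)
    (-Wᵀ) (L₂ + Matrix.diagonal (Wᵀ *ᵥ fun _ => 1))

noncomputable def lam2 {K : Type*} [Fintype K] (M : Matrix K K ℝ) : ℝ :=
  sInf {r : ℝ | ∃ v : K → ℝ, v ≠ 0 ∧ (∑ i, v i) = 0 ∧
    r = (v ⬝ᵥ (M *ᵥ v)) / (∑ i, (v i) ^ 2)}

theorem supraLap_quad {n m : ℕ} (L₁ : Matrix (Fin n) (Fin n) ℝ)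
    (L₂ : Matrix (Fin m) (Fin m) ℝ) (W : Matrix (Fin n) (Fin m) ℝ)
    (a : Fin n → ℝ) (b : Fin m → ℝ) :
    Sum.elim a b ⬝ᵥ (supraLap L₁ L₂ W *ᵥ Sum.elim a b) =
      a ⬝ᵥ (L₁ *ᵥ a) + b ⬝ᵥ (L₂ *ᵥ b) + ∑ i, ∑ j, W i j * (a i - b j) ^ 2 := by
  have h1 : a ⬝ᵥ (Matrix.diagonal (W *ᵥ fun _ => 1) *ᵥ a) = ∑ i, ∑ j, W i j * a i ^ 2 := by
    simp only [dotProduct, Matrix.mulVec]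
    refine Finset.sum_congr rfl fun i _ => ?_
    rw [← Finset.sum_mul]
    simp [Matrix.diagonal_apply, Matrix.mulVec, dotProduct]
    ring
  have h2 : b ⬝ᵥ (Matrix.diagonal (Wᵀ *ᵥ fun _ => 1) *ᵥ b) = ∑ i, ∑ j, W i j * b j ^ 2 := by
    rw [Finset.sum_comm]
    simp only [dotProduct, Matrix.mulVec]
    refine Finset.sum_congr rfl fun i _ => ?_
    rw [← Finset.sum_mul]
    simp [Matrix.diagonal_apply, Matrix.mulVec, dotProduct]
    ring
  have h3 : a ⬝ᵥ (W *ᵥ b) = ∑ i, ∑ j, W i j * (a i * b j) := by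
    simp only [dotProduct, Matrix.mulVec, Finset.mul_sum]
    exact Finset.sum_congr rfl fun i _ => Finset.sum_congr rfl fun j _ => by ring
  have h4 : b ⬝ᵥ (Wᵀ *ᵥ a) = ∑ i, ∑ j, W i j * (a i * b j) := by
    rw [Finset.sum_comm]
    simp only [dotProduct, Matrix.mulVec, Finset.mul_sum, Matrix.transpose_apply]
    exact Finset.sum_congr rfl fun i _ => Finset.sum_congr rfl fun j _ => by ring
  have h5 : ∑ i, ∑ j, W i j * (a i - b j) ^ 2 = ∑ i, ∑ j, W i j * a i ^ 2
      + ∑ i, ∑ j, W i j * b j ^ 2 - 2 * ∑ i, ∑ j, W i j * (a i * b j) := by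
    simp only [Finset.mul_sum, ← Finset.sum_add_distrib, ← Finset.sum_sub_distrib]
    exact Finset.sum_congr rfl fun i _ => Finset.sum_congr rfl fun j _ => by ring
  rw [supraLap, Matrix.fromBlocks_mulVec, Sum.elim_comp_inl, Sum.elim_comp_inr,
    sumElim_dotProduct_sumElim]
  simp only [Matrix.add_mulVec, Matrix.neg_mulVec, dotProduct_add, dotProduct_neg]
  rw [h1, h2, h3, h4, h5]
  ring

theorem stmt_6 {n m : ℕ} (hn : 2 ≤ n) (hm : 2 ≤ m)
    (L₁ : Matrix (Fin n) (Fin n) ℝ) (L₂ : Matrix (Fin m) (Fin m) ℝ)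
    (hL₁ : L₁.PosSemidef) (hL₂ : L₂.PosSemidef)
    (hL₁1 : L₁ *ᵥ (fun _ => 1) = 0) (hL₂1 : L₂ *ᵥ (fun _ => 1) = 0)
    (v : Fin m → ℝ) (hvnorm : (∑ j, (v j) ^ 2) = 1) (hvsum : (∑ j, v j) = 0)
    (hveig : L₂ *ᵥ v = lam2 L₂ • v)
    (W : Matrix (Fin n) (Fin m) ℝ) (hW : ∀ i j, 0 ≤ W i j) :
    lam2 (supraLap L₁ L₂ W) ≤
      lam2 L₂ + v ⬝ᵥ (Matrix.diagonal (Wᵀ *ᵥ fun _ => 1) *ᵥ v) := by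
  have hq := supraLap_quad L₁ L₂ W 0 v
  have hd : v ⬝ᵥ (Matrix.diagonal (Wᵀ *ᵥ fun _ => 1) *ᵥ v) = ∑ i, ∑ j, W i j * v j ^ 2 := by
    rw [Finset.sum_comm]
    simp only [dotProduct, Matrix.mulVec]
    refine Finset.sum_congr rfl fun i _ => ?_
    rw [← Finset.sum_mul]
    simp [Matrix.diagonal_apply, Matrix.mulVec, dotProduct]
    ring
  have hvv : v ⬝ᵥ v = 1 := by
    rw [← hvnorm]
    exact Finset.sum_congr rfl fun j _ => by ring
  rw [lam2]
  apply csInf_le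
  · refine ⟨0, ?_⟩
    rintro r ⟨x, -, -, rfl⟩
    refine div_nonneg ?_ (Finset.sum_nonneg fun i _ => sq_nonneg _)
    rw [← Sum.elim_comp_inl_inr x, supraLap_quad]
    have h1 := hL₁.dotProduct_mulVec_nonneg (x ∘ Sum.inl)
    have h2 := hL₂.dotProduct_mulVec_nonneg (x ∘ Sum.inr)
    simp only [star_trivial] at h1 h2
    have h3 : 0 ≤ ∑ i, ∑ j, W i j * ((x ∘ Sum.inl) i - (x ∘ Sum.inr) j) ^ 2 :=
      Finset.sum_nonneg fun i _ => Finset.sum_nonneg fun j _ =>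
        mul_nonneg (hW i j) (sq_nonneg _)
    linarith
  · refine ⟨Sum.elim 0 v, ?_, ?_, ?_⟩
    · intro h
      have hv : v = 0 := by
        funext j
        exact congrFun h (Sum.inr j)
      simp [hv] at hvnorm
    · simp [Fintype.sum_sum_type, hvsum]
    · rw [hq, hd, hveig]
      simp [Fintype.sum_sum_type, hvnorm, hvv]
end

section
/- For c ≥ 0 and uniform all-pairs interlayer weights W_c = (c/(nm))J, the algebraic connectivity of the supra-Laplacian attains the upper bound, λ₂(L(W_c)) = (1/n + 1/m)·c, if and only if c ≤ min{ m·λ₂(L₁), n·λ₂(L₂) } (this minimum is the transition threshold c*). -/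
open Matrix

lemma aux_sq_pos {K : Type*} [Fintype K] {v : K → ℝ} (hv : v ≠ 0) : 0 < ∑ i, (v i) ^ 2 := by
  obtain ⟨i, hi⟩ := Function.ne_iff.mp hv
  exact Finset.sum_pos' (fun j _ => sq_nonneg _)
    ⟨i, Finset.mem_univ _, by have : v i ≠ 0 := hi
                              positivity⟩

lemma aux_lam2_le {K : Type*} [Fintype K] (M : Matrix K K ℝ)
    (hM : ∀ v : K → ℝ, ∑ i, v i = 0 → 0 ≤ v ⬝ᵥ (M *ᵥ v)) (v : K → ℝ) (hv : ∑ i, v i = 0) :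
    lam2 M * ∑ i, (v i) ^ 2 ≤ v ⬝ᵥ (M *ᵥ v) := by
  by_cases h0 : v = 0
  · subst h0; simp
  have hp := aux_sq_pos h0
  rw [← le_div_iff₀ hp]
  apply csInf_le
  · refine ⟨0, ?_⟩
    rintro r ⟨w, hw, hws, rfl⟩
    exact div_nonneg (hM w hws) (aux_sq_pos hw).le
  · exact ⟨v, h0, hv, rfl⟩

lemma aux_le_lam2 {K : Type*} [Fintype K] (M : Matrix K K ℝ) (a : ℝ)
    (hne : ∃ v : K → ℝ, v ≠ 0 ∧ ∑ i, v i = 0)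
    (h : ∀ v : K → ℝ, ∑ i, v i = 0 → a * ∑ i, (v i) ^ 2 ≤ v ⬝ᵥ (M *ᵥ v)) :
    a ≤ lam2 M := by
  obtain ⟨v, hv, hs⟩ := hne
  unfold lam2
  refine le_csInf ⟨_, v, hv, hs, rfl⟩ ?_
  rintro r ⟨w, hw, hws, rfl⟩
  rw [le_div_iff₀ (aux_sq_pos hw)]
  exact h w hws

lemma aux_ne {n : ℕ} (hn : 2 ≤ n) : ∃ v : Fin n → ℝ, v ≠ 0 ∧ ∑ i, v i = 0 := by
  refine ⟨Pi.single ⟨0, by omega⟩ 1 - Pi.single ⟨1, by omega⟩ 1, ?_, ?_⟩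
  · intro h
    have := congrFun h ⟨0, by omega⟩
    simp [Pi.single_apply] at this
  · simp [Finset.sum_sub_distrib]

lemma aux_shift {n : ℕ} (hn : 2 ≤ n) (L : Matrix (Fin n) (Fin n) ℝ) (hL : L.PosSemidef)
    (h1 : L *ᵥ (fun _ => 1) = 0) (x : Fin n → ℝ) :
    lam2 L * (∑ i, (x i) ^ 2 - (∑ i, x i) ^ 2 / n) ≤ x ⬝ᵥ (L *ᵥ x) := by
  have hn0 : (n : ℝ) ≠ 0 := by positivity
  set s := ∑ i, x i with hs
  have hT : Lᵀ = L := by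
    have := hL.isHermitian
    simpa [Matrix.IsHermitian, conjTranspose_eq_transpose_of_trivial] using this.eq
  have hpos : ∀ v : Fin n → ℝ, 0 ≤ v ⬝ᵥ (L *ᵥ v) := fun v => by
    simpa using hL.dotProduct_mulVec_nonneg v
  have key := aux_lam2_le L (fun v _ => hpos v) (x - (s / n) • (fun _ => 1))
    (by simp [Finset.sum_sub_distrib, ← hs]; field_simp; simp)
  have e1 : (x - (s / n) • (fun _ => (1:ℝ))) ⬝ᵥ (L *ᵥ (x - (s / n) • (fun _ => 1)))
      = x ⬝ᵥ (L *ᵥ x) := by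
    rw [mulVec_sub, mulVec_smul, h1, smul_zero, sub_zero, sub_dotProduct, smul_dotProduct,
      dotProduct_mulVec (fun _ => (1:ℝ)), ← mulVec_transpose, hT, h1]
    simp
  have e2 : ∑ i, ((x - (s / n) • (fun _ => (1:ℝ)) : Fin n → ℝ) i) ^ 2 = ∑ i, (x i) ^ 2 - s ^ 2 / n := by
    have : ∀ i, ((x - (s / n) • (fun _ => (1:ℝ)) : Fin n → ℝ) i) ^ 2
        = (x i) ^ 2 - (2 * (s / n)) * x i + (s / n) ^ 2 := by
      intro i; simp; ring
    simp_rw [this]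
    rw [Finset.sum_add_distrib, Finset.sum_sub_distrib, ← Finset.mul_sum, ← hs]
    simp
    field_simp
    ring
  rwa [e1, e2] at key

lemma aux_form {n m : ℕ} (hn : 2 ≤ n) (hm : 2 ≤ m) (L₁ : Matrix (Fin n) (Fin n) ℝ)
    (L₂ : Matrix (Fin m) (Fin m) ℝ) (c : ℝ) (x : Fin n → ℝ) (y : Fin m → ℝ) :
    Sum.elim x y ⬝ᵥ (supraLap L₁ L₂ (Matrix.of fun _ _ => c / ((n : ℝ) * m)) *ᵥ Sum.elim x y)
      = x ⬝ᵥ (L₁ *ᵥ x) + y ⬝ᵥ (L₂ *ᵥ y) + c / n * ∑ i, (x i) ^ 2 + c / m * ∑ i, (y i) ^ 2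
        - 2 * c / (n * m) * (∑ i, x i) * ∑ i, y i := by
  have hn0 : (n : ℝ) ≠ 0 := by positivity
  have hm0 : (m : ℝ) ≠ 0 := by positivity
  have d1 : (Matrix.of fun (_ : Fin n) (_ : Fin m) => c / ((n : ℝ) * m)) *ᵥ (fun _ => 1)
      = fun _ => c / n := by
    ext i; simp [mulVec, dotProduct]; field_simp
  have d2 : (Matrix.of fun (_ : Fin n) (_ : Fin m) => c / ((n : ℝ) * m))ᵀ *ᵥ (fun _ => 1)
      = fun _ => c / m := by
    ext i; simp [mulVec, dotProduct]; field_simp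
  have d3 : (Matrix.of fun (_ : Fin n) (_ : Fin m) => c / ((n : ℝ) * m)) *ᵥ y
      = fun _ => c / (n * m) * ∑ i, y i := by
    ext i; simp [mulVec, dotProduct, Finset.mul_sum]
  have d4 : (Matrix.of fun (_ : Fin n) (_ : Fin m) => c / ((n : ℝ) * m))ᵀ *ᵥ x
      = fun _ => c / (n * m) * ∑ i, x i := by
    ext i; simp [mulVec, dotProduct, Finset.mul_sum]
  have q : ∀ (k : ℕ) (z : Fin k → ℝ) (a : ℝ),
      z ⬝ᵥ (diagonal (fun _ => a) *ᵥ z) = a * ∑ i, (z i) ^ 2 := by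
    intro k z a
    simp only [dotProduct, mulVec_diagonal, Finset.mul_sum]
    exact Finset.sum_congr rfl fun i _ => by ring
  have r : ∀ (k : ℕ) (z : Fin k → ℝ) (a : ℝ), z ⬝ᵥ (fun _ => a) = (∑ i, z i) * a := by
    intro k z a
    simp only [dotProduct, Finset.sum_mul]
  unfold supraLap
  rw [d1, d2, fromBlocks_mulVec, sumElim_dotProduct_sumElim]
  simp only [Sum.elim_comp_inl, Sum.elim_comp_inr, add_mulVec, neg_mulVec, dotProduct_add,
    dotProduct_neg, q, d3, d4, r]
  ring

theorem stmt_13 {n m : ℕ} (hn : 2 ≤ n) (hm : 2 ≤ m)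
    (L₁ : Matrix (Fin n) (Fin n) ℝ) (L₂ : Matrix (Fin m) (Fin m) ℝ)
    (hL₁ : L₁.PosSemidef) (hL₂ : L₂.PosSemidef)
    (hL₁1 : L₁ *ᵥ (fun _ => 1) = 0) (hL₂1 : L₂ *ᵥ (fun _ => 1) = 0)
    (c : ℝ) (hc : 0 ≤ c) :
    lam2 (supraLap L₁ L₂ (Matrix.of fun _ _ => c / ((n : ℝ) * m))) =
        (1 / (n : ℝ) + 1 / (m : ℝ)) * c ↔
      c ≤ min ((m : ℝ) * lam2 L₁) ((n : ℝ) * lam2 L₂) := by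
  have hn0 : (0 : ℝ) < n := by positivity
  have hm0 : (0 : ℝ) < m := by positivity
  have p1 : ∀ v : Fin n → ℝ, 0 ≤ v ⬝ᵥ (L₁ *ᵥ v) := fun v => by
    simpa using hL₁.dotProduct_mulVec_nonneg v
  have p2 : ∀ v : Fin m → ℝ, 0 ≤ v ⬝ᵥ (L₂ *ᵥ v) := fun v => by
    simpa using hL₂.dotProduct_mulVec_nonneg v
  have F := aux_form hn hm L₁ L₂ c
  set M := supraLap L₁ L₂ (Matrix.of fun _ _ => c / ((n : ℝ) * m)) with hM
  have split : ∀ v : Fin n ⊕ Fin m → ℝ, ∃ x y, v = Sum.elim x y := fun v =>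
    ⟨v ∘ Sum.inl, v ∘ Sum.inr, (Sum.elim_comp_inl_inr v).symm⟩
  have pM : ∀ v : Fin n ⊕ Fin m → ℝ, ∑ i, v i = 0 → 0 ≤ v ⬝ᵥ (M *ᵥ v) := by
    intro v hv
    obtain ⟨x, y, rfl⟩ := split v
    simp only [Fintype.sum_sum_type, Sum.elim_inl, Sum.elim_inr] at hv
    rw [F, eq_neg_of_add_eq_zero_right hv]
    have := p1 x
    have := p2 y
    have h1 : 0 ≤ c / n * ∑ i, (x i) ^ 2 := by positivity
    have h2 : 0 ≤ c / m * ∑ i, (y i) ^ 2 := by positivity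
    have h3 : 0 ≤ 2 * c / (n * m) * (∑ i, x i) ^ 2 := by positivity
    linarith
  constructor
  · intro h
    apply le_min
    · rw [← div_le_iff₀' hm0]
      apply aux_le_lam2 _ _ (aux_ne hn)
      intro x hx
      have := aux_lam2_le M pM (Sum.elim x 0) (by simp [hx])
      rw [F, h, hx] at this
      simp at this
      have e : ((n : ℝ)⁻¹ + (m : ℝ)⁻¹) * c * ∑ i, (x i) ^ 2
        = c / m * ∑ i, (x i) ^ 2 + c / n * ∑ i, (x i) ^ 2 := by ring
      linarith
    · rw [← div_le_iff₀' hn0]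
      apply aux_le_lam2 _ _ (aux_ne hm)
      intro x hx
      have := aux_lam2_le M pM (Sum.elim 0 x) (by simp [hx])
      rw [F, h, hx] at this
      simp at this
      have e : ((n : ℝ)⁻¹ + (m : ℝ)⁻¹) * c * ∑ i, (x i) ^ 2
        = c / m * ∑ i, (x i) ^ 2 + c / n * ∑ i, (x i) ^ 2 := by ring
      linarith
  · intro h
    obtain ⟨h1, h2⟩ := le_min_iff.mp h
    rw [← div_le_iff₀' hm0] at h1
    rw [← div_le_iff₀' hn0] at h2
    have cs : ∀ (k : ℕ), 0 < (k : ℝ) → ∀ z : Fin k → ℝ,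
        0 ≤ ∑ i, (z i) ^ 2 - (∑ i, z i) ^ 2 / k := by
      intro k hk z
      rw [sub_nonneg, div_le_iff₀' hk]
      simpa using sq_sum_le_card_mul_sum_sq (s := Finset.univ) (f := z)
    apply le_antisymm
    · have := aux_lam2_le M pM (Sum.elim (fun _ => 1 / (n : ℝ)) (fun _ => - (1 / (m : ℝ))))
        (by simp [hn0.ne', hm0.ne'])
      have z1 : (L₁ *ᵥ fun _ => 1 / (n : ℝ)) = 0 := by
        have : (fun _ : Fin n => 1 / (n : ℝ)) = (1 / (n : ℝ)) • (fun _ => 1) := by ext; simp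
        rw [this, mulVec_smul, hL₁1, smul_zero]
      have z2 : (L₂ *ᵥ fun _ => -(1 / (m : ℝ))) = 0 := by
        have : (fun _ : Fin m => -(1 / (m : ℝ))) = (-(1 / (m : ℝ))) • (fun _ => 1) := by
          ext; simp
        rw [this, mulVec_smul, hL₂1, smul_zero]
      rw [F, z1, z2] at this
      simp only [Fintype.sum_sum_type, Sum.elim_inl, Sum.elim_inr, Finset.sum_const,
        Finset.card_univ, Fintype.card_fin, nsmul_eq_mul, dotProduct_zero] at this
      have hp : (0 : ℝ) < 1 / n + 1 / m := by positivity
      refine le_of_mul_le_mul_right ?_ hp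
      calc _ = lam2 M * (n * (1 / (n:ℝ)) ^ 2 + m * (-(1 / (m:ℝ))) ^ 2) := by
            congr 1; field_simp
        _ ≤ _ := this
        _ = _ := by field_simp; ring
    · apply aux_le_lam2
      · obtain ⟨x, hx, hs⟩ := aux_ne hn
        refine ⟨Sum.elim x 0, fun h0 => hx ?_, by simp [hs]⟩
        ext i
        simpa using congrFun h0 (Sum.inl i)
      · intro v hv
        obtain ⟨x, y, rfl⟩ := split v
        simp only [Fintype.sum_sum_type, Sum.elim_inl, Sum.elim_inr] at hv ⊢
        have a1 := (mul_le_mul_of_nonneg_right h1 (cs n hn0 x)).trans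
          (aux_shift hn L₁ hL₁ hL₁1 x)
        have a2 := (mul_le_mul_of_nonneg_right h2 (cs m hm0 y)).trans
          (aux_shift hm L₂ hL₂ hL₂1 y)
        rw [F]
        rw [eq_neg_of_add_eq_zero_right hv] at a2 ⊢
        refine le_trans (le_of_eq ?_) (sub_le_sub_right (add_le_add_left (add_le_add_left
          (add_le_add a1 a2) _) _) _)
        field_simp
        ring
end

section
/- (Case 1: two transitions.) Write λ₂⁽¹⁾ = λ₂(L₁) and λ₂⁽²⁾ = λ₂(L₂), and assume n > m and m·λ₂⁽¹⁾ > n·λ₂⁽²⁾ (i.e. the specific algebraic connectivity of layer 1 exceeds that of layer 2: λ₂⁽¹⁾/n > λ₂⁽²⁾/m). Set c* = n·λ₂⁽²⁾ and c** = nm(λ₂⁽¹⁾ − λ₂⁽²⁾)/(n − m). Then c* ≤ c**, and for uniform all-pairs weights: λ₂(L(W_c)) = (1/n + 1/m)·c for 0 ≤ c ≤ c*; λ₂(L(W_c)) = λ₂⁽²⁾ + c/m for c* ≤ c ≤ c**; and λ₂(L(W_c)) = λ₂⁽¹⁾ + c/n for c ≥ c**. -/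
open Matrix

theorem lam2_bdd {K : Type*} [Fintype K] (M : Matrix K K ℝ) (k : ℝ)
    (h : ∀ v : K → ℝ, ∑ i, v i = 0 → k * ∑ i, (v i)^2 ≤ v ⬝ᵥ (M *ᵥ v)) :
    ∀ r ∈ {r : ℝ | ∃ v : K → ℝ, v ≠ 0 ∧ (∑ i, v i) = 0 ∧
      r = (v ⬝ᵥ (M *ᵥ v)) / (∑ i, (v i) ^ 2)}, k ≤ r := by
  rintro r ⟨v, hv, hs, rfl⟩
  have hp : 0 < ∑ i, (v i)^2 := by
    obtain ⟨i, hi⟩ := Function.ne_iff.mp hv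
    exact Finset.sum_pos' (fun i _ => sq_nonneg _) ⟨i, Finset.mem_univ _, by
      have : v i ≠ 0 := hi
      positivity⟩
  rw [le_div_iff₀ hp]
  exact h v hs

theorem lam2_low {K : Type*} [Fintype K] (M : Matrix K K ℝ) (k : ℝ)
    (h : ∀ v : K → ℝ, ∑ i, v i = 0 → k * ∑ i, (v i)^2 ≤ v ⬝ᵥ (M *ᵥ v))
    (v : K → ℝ) (hs : ∑ i, v i = 0) : lam2 M * ∑ i, (v i)^2 ≤ v ⬝ᵥ (M *ᵥ v) := by
  by_cases hv : v = 0
  · subst hv; simp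
  have hp : 0 < ∑ i, (v i)^2 := by
    obtain ⟨i, hi⟩ := Function.ne_iff.mp hv
    exact Finset.sum_pos' (fun i _ => sq_nonneg _) ⟨i, Finset.mem_univ _, by
      have : v i ≠ 0 := hi
      positivity⟩
  rw [← le_div_iff₀ hp]
  exact csInf_le ⟨k, fun r hr => lam2_bdd M k h r hr⟩ ⟨v, hv, hs, rfl⟩

theorem le_lam2 {K : Type*} [Fintype K] [Nontrivial K] (M : Matrix K K ℝ) (k : ℝ)
    (h : ∀ v : K → ℝ, ∑ i, v i = 0 → k * ∑ i, (v i)^2 ≤ v ⬝ᵥ (M *ᵥ v)) :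
    k ≤ lam2 M := by
  classical
  refine le_csInf ?_ (lam2_bdd M k h)
  obtain ⟨i, j, hij⟩ := exists_pair_ne K
  refine ⟨_, Pi.single i 1 - Pi.single j 1, ?_, ?_, rfl⟩
  · intro h0
    have := congrFun h0 i
    simp [hij] at this
  · simp

theorem quad_shift {K : Type*} [Fintype K] (M : Matrix K K ℝ) (hM : M.PosSemidef)
    (h1 : M *ᵥ (fun _ => 1) = 0) (x : K → ℝ) (a : ℝ) :
    (fun i => x i - a) ⬝ᵥ (M *ᵥ (fun i => x i - a)) = x ⬝ᵥ (M *ᵥ x) := by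
  have ht : Mᵀ = M := by
    have := hM.isHermitian.eq
    rwa [Matrix.conjTranspose_eq_transpose_of_trivial] at this
  have e : (fun i => x i - a) = x - a • (fun _ => (1:ℝ)) := by
    ext i; simp
  have h2 : (fun _ => (1:ℝ)) ⬝ᵥ (M *ᵥ x) = 0 := by
    rw [Matrix.dotProduct_mulVec, ← Matrix.mulVec_transpose, ht, h1, zero_dotProduct]
  rw [e, Matrix.mulVec_sub, Matrix.mulVec_smul, h1, smul_zero, sub_zero, sub_dotProduct,
    smul_dotProduct, h2, smul_zero, sub_zero]

theorem quad_supra {n m : ℕ} (hn : 2 ≤ n) (hm : 2 ≤ m) (L₁ : Matrix (Fin n) (Fin n) ℝ)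
    (L₂ : Matrix (Fin m) (Fin m) ℝ) (c : ℝ) (v : Fin n ⊕ Fin m → ℝ) :
    v ⬝ᵥ (supraLap L₁ L₂ (Matrix.of fun _ _ => c / ((n : ℝ) * m)) *ᵥ v) =
      (fun i => v (.inl i)) ⬝ᵥ (L₁ *ᵥ fun i => v (.inl i)) +
      (fun i => v (.inr i)) ⬝ᵥ (L₂ *ᵥ fun i => v (.inr i)) +
      c / n * ∑ i, (v (.inl i))^2 + c / m * ∑ i, (v (.inr i))^2 -
      2 * (c / (n * m)) * (∑ i, v (.inl i)) * (∑ i, v (.inr i)) := by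
  obtain ⟨x, y, rfl⟩ : ∃ x y, v = Sum.elim x y :=
    ⟨v ∘ Sum.inl, v ∘ Sum.inr, (Sum.elim_comp_inl_inr v).symm⟩
  have hn0 : (n:ℝ) ≠ 0 := by positivity
  have hm0 : (m:ℝ) ≠ 0 := by positivity
  have hW : ∀ w : ℝ, ((Matrix.of fun (_ : Fin n) (_ : Fin m) => w) *ᵥ y) = fun _ => w * ∑ i, y i := by
    intro w; ext i; simp [Matrix.mulVec, dotProduct, Finset.mul_sum]
  have hW' : ∀ w : ℝ, ((Matrix.of fun (_ : Fin n) (_ : Fin m) => w)ᵀ *ᵥ x) = fun _ => w * ∑ i, x i := by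
    intro w; ext i; simp [Matrix.mulVec, dotProduct, Finset.mul_sum]
  have d1 : ((Matrix.of fun (_ : Fin n) (_ : Fin m) => c / ((n : ℝ) * m)) *ᵥ fun _ => 1)
      = fun _ => c / n := by
    ext i; simp [Matrix.mulVec, dotProduct]; field_simp
  have d2 : ((Matrix.of fun (_ : Fin n) (_ : Fin m) => c / ((n : ℝ) * m))ᵀ *ᵥ fun _ => 1)
      = fun _ => c / m := by
    ext i; simp [Matrix.mulVec, dotProduct]; field_simp
  have e1 : x ⬝ᵥ (Matrix.diagonal (fun _ => c / (n:ℝ)) *ᵥ x) = c / n * ∑ i, (x i)^2 := by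
    simp only [dotProduct, Matrix.mulVec_diagonal, Finset.mul_sum]
    exact Finset.sum_congr rfl fun i _ => by ring
  have e2 : y ⬝ᵥ (Matrix.diagonal (fun _ => c / (m:ℝ)) *ᵥ y) = c / m * ∑ i, (y i)^2 := by
    simp only [dotProduct, Matrix.mulVec_diagonal, Finset.mul_sum]
    exact Finset.sum_congr rfl fun i _ => by ring
  have f1 : ∀ s : ℝ, x ⬝ᵥ (fun _ => s) = s * ∑ i, x i := by
    intro s; simp [dotProduct, Finset.mul_sum, mul_comm]
  have f2 : ∀ s : ℝ, y ⬝ᵥ (fun _ => s) = s * ∑ i, y i := by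
    intro s; simp [dotProduct, Finset.mul_sum, mul_comm]
  simp only [supraLap, Matrix.fromBlocks_mulVec, d1, d2, Sum.elim_comp_inl, Sum.elim_comp_inr,
    Sum.elim_inl, Sum.elim_inr, sumElim_dotProduct_sumElim, Matrix.add_mulVec, Matrix.neg_mulVec, hW, hW',
    dotProduct_add, dotProduct_neg, e1, e2, f1, f2]
  ring

theorem sq_shift {n : ℕ} (hn : 2 ≤ n) (x : Fin n → ℝ) :
    ∑ i, (x i - (∑ j, x j) / n)^2 = ∑ i, (x i)^2 - (∑ j, x j)^2 / n := by
  have hn0 : (n:ℝ) ≠ 0 := by positivity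
  simp only [sub_sq, Finset.sum_add_distrib, Finset.sum_sub_distrib, ← Finset.sum_mul,
    ← Finset.mul_sum]
  simp
  field_simp
  ring

theorem sum_shift {n : ℕ} (hn : 2 ≤ n) (x : Fin n → ℝ) :
    ∑ i, (x i - (∑ j, x j) / n) = 0 := by
  have hn0 : (n:ℝ) ≠ 0 := by positivity
  simp only [Finset.sum_sub_distrib]
  simp
  field_simp
  ring

theorem psd_low {K : Type*} [Fintype K] (M : Matrix K K ℝ) (hM : M.PosSemidef) :
    ∀ v : K → ℝ, ∑ i, v i = 0 → 0 * ∑ i, (v i)^2 ≤ v ⬝ᵥ (M *ᵥ v) := by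
  intro v _
  rw [zero_mul]
  simpa using hM.dotProduct_mulVec_nonneg v

theorem supra_low {n m : ℕ} (hn : 2 ≤ n) (hm : 2 ≤ m)
    (L₁ : Matrix (Fin n) (Fin n) ℝ) (L₂ : Matrix (Fin m) (Fin m) ℝ)
    (hL₁ : L₁.PosSemidef) (hL₂ : L₂.PosSemidef)
    (hL₁1 : L₁ *ᵥ (fun _ => 1) = 0) (hL₂1 : L₂ *ᵥ (fun _ => 1) = 0) (c k : ℝ)
    (k1 : k ≤ lam2 L₁ + c / n) (k2 : k ≤ lam2 L₂ + c / m)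
    (k3 : k ≤ (1 / (n : ℝ) + 1 / (m : ℝ)) * c) :
    ∀ v : Fin n ⊕ Fin m → ℝ, ∑ i, v i = 0 → k * ∑ i, (v i)^2 ≤
      v ⬝ᵥ (supraLap L₁ L₂ (Matrix.of fun _ _ => c / ((n : ℝ) * m)) *ᵥ v) := by
  intro v hv
  have hn0 : (0:ℝ) < n := by positivity
  have hm0 : (0:ℝ) < m := by positivity
  rw [quad_supra hn hm]
  rw [Fintype.sum_sum_type] at hv ⊢
  have A := lam2_low L₁ 0 (psd_low L₁ hL₁) _ (sum_shift hn fun i => v (.inl i))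
  have B := lam2_low L₂ 0 (psd_low L₂ hL₂) _ (sum_shift hm fun i => v (.inr i))
  have A0 : 0 ≤ ∑ i, (v (.inl i) - (∑ j, v (.inl j)) / n)^2 := Finset.sum_nonneg fun i _ => sq_nonneg _
  have B0 : 0 ≤ ∑ i, (v (.inr i) - (∑ j, v (.inr j)) / m)^2 := Finset.sum_nonneg fun i _ => sq_nonneg _
  rw [quad_shift L₁ hL₁ hL₁1 (fun i => v (.inl i)), sq_shift hn] at A
  rw [quad_shift L₂ hL₂ hL₂1 (fun i => v (.inr i)), sq_shift hm] at B
  rw [sq_shift hn fun i => v (.inl i)] at A0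
  rw [sq_shift hm fun i => v (.inr i)] at B0
  generalize (fun i => v (.inl i)) ⬝ᵥ (L₁ *ᵥ fun i => v (.inl i)) = q1 at *
  generalize (fun i => v (.inr i)) ⬝ᵥ (L₂ *ᵥ fun i => v (.inr i)) = q2 at *
  generalize ∑ i, (v (.inl i))^2 = X at *
  generalize ∑ i, (v (.inr i))^2 = Y at *
  have hs : ∑ i, v (.inr i) = - ∑ i, v (.inl i) := by linarith
  rw [hs, neg_sq] at B B0
  rw [hs]
  clear hs hv
  generalize ∑ i, v (.inl i) = s at *
  have g1 := mul_le_mul_of_nonneg_right k1 A0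
  have g2 := mul_le_mul_of_nonneg_right k2 B0
  have g3 := mul_le_mul_of_nonneg_right k3 (by positivity : 0 ≤ s^2 / n + s^2 / m)
  have e : (1 / (n : ℝ) + 1 / (m : ℝ)) * c * (s^2 / n + s^2 / m) =
    c / n * (s^2/n) + c / m * (s^2/m) + 2 * (c / (n*m)) * s * s := by
    field_simp
    ring
  linarith

theorem supra_eq {n m : ℕ} (hn : 2 ≤ n) (hm : 2 ≤ m)
    (L₁ : Matrix (Fin n) (Fin n) ℝ) (L₂ : Matrix (Fin m) (Fin m) ℝ)
    (hL₁ : L₁.PosSemidef) (hL₂ : L₂.PosSemidef)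
    (hL₁1 : L₁ *ᵥ (fun _ => 1) = 0) (hL₂1 : L₂ *ᵥ (fun _ => 1) = 0) (c : ℝ) :
    lam2 (supraLap L₁ L₂ (Matrix.of fun _ _ => c / ((n : ℝ) * m))) =
      min (min (lam2 L₁ + c / n) (lam2 L₂ + c / m)) ((1 / (n : ℝ) + 1 / (m : ℝ)) * c) := by
  have hn0 : (0:ℝ) < n := by positivity
  have hm0 : (0:ℝ) < m := by positivity
  have : Nontrivial (Fin n) := Fin.nontrivial_iff_two_le.mpr hn
  have : Nontrivial (Fin m) := Fin.nontrivial_iff_two_le.mpr hm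
  have : Nontrivial (Fin n ⊕ Fin m) := Sum.inl_injective.nontrivial
  have low := supra_low hn hm L₁ L₂ hL₁ hL₂ hL₁1 hL₂1 c
    (min (min (lam2 L₁ + c / n) (lam2 L₂ + c / m)) ((1 / (n : ℝ) + 1 / (m : ℝ)) * c))
    ((min_le_left _ _).trans (min_le_left _ _)) ((min_le_left _ _).trans (min_le_right _ _))
    (min_le_right _ _)
  apply le_antisymm
  · have key := lam2_low _ _ low
    generalize hl : lam2 (supraLap L₁ L₂ (Matrix.of fun _ _ => c / ((n : ℝ) * m))) = l at *
    refine le_min (le_min ?_ ?_) ?_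
    · rw [← sub_le_iff_le_add]
      apply le_lam2
      intro x hx
      have := key (Sum.elim x 0) (by simp [hx])
      rw [quad_supra hn hm, Fintype.sum_sum_type] at this
      simp [hx] at this
      change _ ≤ x ⬝ᵥ (L₁ *ᵥ x) + _ at this
      linarith
    · rw [← sub_le_iff_le_add]
      apply le_lam2
      intro x hx
      have := key (Sum.elim 0 x) (by simp [hx])
      rw [quad_supra hn hm, Fintype.sum_sum_type] at this
      simp [hx] at this
      change _ ≤ x ⬝ᵥ (L₂ *ᵥ x) + _ at this
      linarith
    · have := key (Sum.elim (fun _ => (m:ℝ)) (fun _ => -(n:ℝ))) (by simp; ring)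
      rw [quad_supra hn hm, Fintype.sum_sum_type] at this
      have z1 : (fun _ => (m:ℝ) : Fin n → ℝ) ⬝ᵥ (L₁ *ᵥ fun _ => (m:ℝ)) = 0 := by
        have : (fun _ => (m:ℝ) : Fin n → ℝ) = (m:ℝ) • fun _ => 1 := by ext; simp
        rw [this, Matrix.mulVec_smul, hL₁1]; simp
      have z2 : (fun _ => -(n:ℝ) : Fin m → ℝ) ⬝ᵥ (L₂ *ᵥ fun _ => -(n:ℝ)) = 0 := by
        have : (fun _ => -(n:ℝ) : Fin m → ℝ) = (-(n:ℝ)) • fun _ => 1 := by ext; simp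
        rw [this, Matrix.mulVec_smul, hL₂1]; simp
      simp only [Sum.elim_inl, Sum.elim_inr, z1, z2] at this
      simp at this
      have hp : (0:ℝ) < n * m^2 + m * n^2 := by positivity
      refine le_of_mul_le_mul_right (this.trans (le_of_eq ?_)) hp
      field_simp
      ring
  · exact le_lam2 _ _ low

theorem stmt_14 {n m : ℕ} (hn : 2 ≤ n) (hm : 2 ≤ m)
    (L₁ : Matrix (Fin n) (Fin n) ℝ) (L₂ : Matrix (Fin m) (Fin m) ℝ)
    (hL₁ : L₁.PosSemidef) (hL₂ : L₂.PosSemidef)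
    (hL₁1 : L₁ *ᵥ (fun _ => 1) = 0) (hL₂1 : L₂ *ᵥ (fun _ => 1) = 0)
    (hnm : n > m) (hspec : (m : ℝ) * lam2 L₁ > (n : ℝ) * lam2 L₂) :
    let cstar : ℝ := (n : ℝ) * lam2 L₂
    let cstarstar : ℝ := (n : ℝ) * m * (lam2 L₁ - lam2 L₂) / ((n : ℝ) - m)
    cstar ≤ cstarstar ∧
    (∀ c : ℝ, 0 ≤ c → c ≤ cstar →
      lam2 (supraLap L₁ L₂ (Matrix.of fun _ _ => c / ((n : ℝ) * m))) =
        (1 / (n : ℝ) + 1 / (m : ℝ)) * c) ∧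
    (∀ c : ℝ, cstar ≤ c → c ≤ cstarstar →
      lam2 (supraLap L₁ L₂ (Matrix.of fun _ _ => c / ((n : ℝ) * m))) =
        lam2 L₂ + c / m) ∧
    (∀ c : ℝ, cstarstar ≤ c →
      lam2 (supraLap L₁ L₂ (Matrix.of fun _ _ => c / ((n : ℝ) * m))) =
        lam2 L₁ + c / n) := by
  have hn0 : (0:ℝ) < n := by positivity
  have hm0 : (0:ℝ) < m := by positivity
  have hd : (0:ℝ) < n - m := by
    have : (m:ℝ) < n := by exact_mod_cast hnm
    linarith
  intro cstar cstarstar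
  have hss : cstar ≤ cstarstar := by
    simp only [cstar, cstarstar]
    rw [le_div_iff₀ hd]
    nlinarith
  have h2 : ∀ c : ℝ, cstar ≤ c ↔ lam2 L₂ ≤ c / n := by
    intro c; rw [le_div_iff₀ hn0, mul_comm]
  have h2' : ∀ c : ℝ, c ≤ cstar ↔ c / n ≤ lam2 L₂ := by
    intro c; rw [div_le_iff₀ hn0, mul_comm]
  have e : ∀ c : ℝ, c / m - c / n = c * (n - m) / (n * m) := by
    intro c; field_simp
  have h3 : ∀ c : ℝ, cstarstar ≤ c ↔ lam2 L₁ - lam2 L₂ ≤ c / m - c / n := by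
    intro c; rw [e, le_div_iff₀ (by positivity), div_le_iff₀ hd, mul_comm]
  have h3' : ∀ c : ℝ, c ≤ cstarstar ↔ c / m - c / n ≤ lam2 L₁ - lam2 L₂ := by
    intro c; rw [e, div_le_iff₀ (by positivity), le_div_iff₀ hd, mul_comm (lam2 L₁ - lam2 L₂)]
  have e3 : ∀ c : ℝ, (1 / (n : ℝ) + 1 / (m : ℝ)) * c = c / n + c / m := by
    intro c; ring
  refine ⟨hss, ?_, ?_, ?_⟩
  · intro c _ hc
    rw [supra_eq hn hm L₁ L₂ hL₁ hL₂ hL₁1 hL₂1, e3]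
    have a := (h2' c).1 hc
    have b := (h3' c).1 (hc.trans hss)
    exact min_eq_right (le_min (by
      have : c / m ≤ lam2 L₁ := by linarith
      linarith) (by linarith))
  · intro c hc hc'
    rw [supra_eq hn hm L₁ L₂ hL₁ hL₂ hL₁1 hL₂1, e3]
    have a := (h2 c).1 hc
    have b := (h3' c).1 hc'
    have q : lam2 L₂ + c / m ≤ lam2 L₁ + c / n := by linarith
    rw [min_eq_right q, min_eq_left (by linarith)]
  · intro c hc
    rw [supra_eq hn hm L₁ L₂ hL₁ hL₂ hL₁1 hL₂1, e3]
    have a := (h2 c).1 (hss.trans hc)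
    have b := (h3 c).1 hc
    have q : lam2 L₁ + c / n ≤ lam2 L₂ + c / m := by linarith
    rw [min_eq_left q, min_eq_left (by linarith)]
end
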